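/- Let p,q ≥ 1, let π ∈ S_ann-nc(p,q), and let ρ ∈ S_disc-nc(p,q). Then π ⪯ ρ̂ in the poset S_nc-sd(p,q) if and only if π₀ ⪯ ρ (that is, Π(π₀) ⪯ Π(ρ) and π₀ is noncrossing on ρ) and all bridges of π are contained in the union of two cycles of ρ (necessarily one contained in [p] and the other in [p+1,p+q]). -/

import Mathlib

namespace AnnNC

/-- The orbit ("same cycle") setoid of a permutation. -/
def orbitSetoid {α : Type*} (σ : Equiv.Perm α) : Setoid α :=
  ⟨σ.SameCycle, ⟨fun x => Equiv.Perm.SameCycle.refl σ x,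
    fun h => h.symm, fun h h' => h.trans h'⟩⟩

/-- Number of orbits (cycles, counting fixed points) of a permutation. -/
noncomputable def numOrbits {α : Type*} (σ : Equiv.Perm α) : ℕ :=
  Nat.card (Quotient (orbitSetoid σ))

/-- Number of blocks of the join `Π(σ) ∨ Π(ρ)` of the orbit partitions. -/
noncomputable def numJoin {α : Type*} (σ ρ : Equiv.Perm α) : ℕ :=
  Nat.card (Quotient (orbitSetoid σ ⊔ orbitSetoid ρ))

/-- Euler characteristic `χ_ρ(π) = #(ρ) + #(π) + #(π⁻¹ρ) − n`. -/
noncomputable def euler {α : Type*} (ρ π : Equiv.Perm α) : ℤ :=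
  (numOrbits ρ : ℤ) + (numOrbits π : ℤ) + (numOrbits (π⁻¹ * ρ) : ℤ) - (Nat.card α : ℤ)

/-- `π` is noncrossing on `ρ`. -/
def IsNoncrossingOn {α : Type*} (π ρ : Equiv.Perm α) : Prop :=
  euler ρ π = 2 * (numJoin π ρ : ℤ)

/-- Euler characteristic of permutations regarded as permutations of a subset `S`
(for permutations fixing the complement of `S` pointwise). -/
noncomputable def eulerOn {α : Type*} (S : Set α) (ρ π : Equiv.Perm α) : ℤ :=
  ((numOrbits ρ : ℤ) - (Nat.card (Sᶜ : Set α) : ℤ)) +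
    ((numOrbits π : ℤ) - (Nat.card (Sᶜ : Set α) : ℤ)) +
    ((numOrbits (π⁻¹ * ρ) : ℤ) - (Nat.card (Sᶜ : Set α) : ℤ)) - (Nat.card (S : Set α) : ℤ)

/-- `π` is noncrossing on `ρ`, both regarded as permutations of the subset `S`. -/
def IsNoncrossingWithin {α : Type*} (S : Set α) (π ρ : Equiv.Perm α) : Prop :=
  eulerOn S ρ π = 2 * ((numJoin π ρ : ℤ) - (Nat.card (Sᶜ : Set α) : ℤ))

/-- `τ_{p,q} = (1,…,p)(p+1,…,p+q)` as a permutation of `Fin (p+q)`. -/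
def tauPQ (p q : ℕ) : Equiv.Perm (Fin (p + q)) :=
  Equiv.permCongr finSumFinEquiv (Equiv.sumCongr (finRotate p) (finRotate q))

/-- Disc-noncrossing permutations: noncrossing on `τ_{p,q}` and the orbit partition
refines that of `τ_{p,q}`. -/
def SDiscNC (p q : ℕ) : Set (Equiv.Perm (Fin (p + q))) :=
  {π | IsNoncrossingOn π (tauPQ p q) ∧
    ∀ x y : Fin (p + q), π.SameCycle x y → ((x : ℕ) < p ↔ (y : ℕ) < p)}

/-- Annular-noncrossing permutations: noncrossing on `τ_{p,q}` with at least one bridge. -/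
def SAnnNC (p q : ℕ) : Set (Equiv.Perm (Fin (p + q))) :=
  {π | IsNoncrossingOn π (tauPQ p q) ∧
    ∃ a b : Fin (p + q), π.SameCycle a b ∧ (a : ℕ) < p ∧ p ≤ (b : ℕ)}

/-- The set of elements lying in bridges of `σ`. -/
def BridgeSet (p q : ℕ) (σ : Equiv.Perm (Fin (p + q))) : Set (Fin (p + q)) :=
  {x | ∃ a b : Fin (p + q), σ.SameCycle x a ∧ σ.SameCycle x b ∧ (a : ℕ) < p ∧ p ≤ (b : ℕ)}

/-- `π₀` is the permutation induced by `π` on the partition `Π(τ_{p,q})`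
(the first–return map of `π` to each of the two sides). -/
def IsPiZero (p q : ℕ) (π π₀ : Equiv.Perm (Fin (p + q))) : Prop :=
  ∀ a : Fin (p + q), ∃ k : ℕ, 0 < k ∧ π₀ a = (π ^ k) a ∧
    (((a : ℕ) < p) ↔ (((π ^ k) a : ℕ) < p)) ∧
    ∀ j : ℕ, 0 < j → j < k → ¬ (((a : ℕ) < p) ↔ (((π ^ j) a : ℕ) < p))

/-- The order `π ⪯ ρ` for (unhatted) permutations: the orbit partition of `π` refines
that of `ρ` and `π` is noncrossing on `ρ`. -/
def permLe {α : Type*} (π ρ : Equiv.Perm α) : Prop :=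
  (∀ x y : α, π.SameCycle x y → ρ.SameCycle x y) ∧ IsNoncrossingOn π ρ

/-- The order relation `π ⪯ ρ̂` in `S_nc-sd(p,q)`, i.e. `Kr(ρ) ⪯ Kr(π)`. -/
def leAnnHat (p q : ℕ) (π ρ : Equiv.Perm (Fin (p + q))) : Prop :=
  permLe (ρ⁻¹ * tauPQ p q) (π⁻¹ * tauPQ p q)

/-- `σ` is the permutation induced by `π` on the subset `J` (first-return map),
extended by the identity off `J`. -/
def IsInducedOn {α : Type*} (π σ : Equiv.Perm α) (J : Set α) : Prop :=
  (∀ a ∉ J, σ a = a) ∧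
  ∀ a ∈ J, ∃ k : ℕ, 0 < k ∧ σ a = (π ^ k) a ∧ (π ^ k) a ∈ J ∧
    ∀ j : ℕ, 0 < j → j < k → (π ^ j) a ∉ J

/-- The size of an orbit of a permutation. -/
noncomputable def orbitSize {α : Type*} (σ : Equiv.Perm α) (c : Quotient (orbitSetoid σ)) : ℕ :=
  Nat.card {x : α // Quotient.mk (orbitSetoid σ) x = c}

/-- `∏_{U ∈ Π(σ)} (−1)^{|U|−1} C_{|U|−1}`. -/
noncomputable def catProd {α : Type*} (σ : Equiv.Perm α) : ℤ :=
  ∏ᶠ c : Quotient (orbitSetoid σ),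
    ((-1 : ℤ) ^ (orbitSize σ c - 1) * (catalan (orbitSize σ c - 1) : ℤ))

/-- The carrier of the poset `S_nc-sd(p,q)`: pairs (permutation, hatted?). -/
def NCSDSet (p q : ℕ) : Set (Equiv.Perm (Fin (p + q)) × Bool) :=
  {z | (z.2 = false ∧ (z.1 ∈ SDiscNC p q ∪ SAnnNC p q)) ∨ (z.2 = true ∧ z.1 ∈ SDiscNC p q)}

/-- The partial order of `S_nc-sd(p,q)`. -/
def ncsdLe (p q : ℕ) (a b : Equiv.Perm (Fin (p + q)) × Bool) : Prop :=
  (a.2 = false ∧ b.2 = false ∧ permLe a.1 b.1) ∨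
  (b.2 = true ∧ permLe (b.1⁻¹ * tauPQ p q) (a.1⁻¹ * tauPQ p q))

section Merge

variable {α : Type*}

/-- The setoid obtained from `r` by merging the classes of `a` and `b`. -/
def mergeSetoid (r : Setoid α) (a b : α) : Setoid α where
  r x y := r x y ∨ (r x a ∧ r y b) ∨ (r x b ∧ r y a)
  iseqv := by
    refine ⟨fun x => Or.inl (r.refl x), ?_, ?_⟩
    · rintro x y (h | ⟨h, h'⟩ | ⟨h, h'⟩)
      · exact Or.inl (r.symm h)
      · exact Or.inr (Or.inr ⟨h', h⟩)
      · exact Or.inr (Or.inl ⟨h', h⟩)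
    · rintro x y z (h | ⟨h, h'⟩ | ⟨h, h'⟩) (k | ⟨k, k'⟩ | ⟨k, k'⟩)
      · exact Or.inl (r.trans h k)
      · exact Or.inr (Or.inl ⟨r.trans h k, k'⟩)
      · exact Or.inr (Or.inr ⟨r.trans h k, k'⟩)
      · exact Or.inr (Or.inl ⟨h, r.trans (r.symm k) h'⟩)
      · exact Or.inr (Or.inl ⟨h, k'⟩)
      · exact Or.inl (r.trans h (r.symm k'))
      · exact Or.inr (Or.inr ⟨h, r.trans (r.symm k) h'⟩)
      · exact Or.inl (r.trans h (r.symm k'))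
      · exact Or.inr (Or.inr ⟨h, k'⟩)

theorem le_mergeSetoid (r : Setoid α) (a b : α) : r ≤ mergeSetoid r a b :=
  fun _ _ h => Or.inl h

theorem mergeSetoid_rel (r : Setoid α) (a b : α) : mergeSetoid r a b a b :=
  Or.inr (Or.inl ⟨r.refl a, r.refl b⟩)

theorem mergeSetoid_le {r s : Setoid α} {a b : α} (h : r ≤ s) (hab : s a b) :
    mergeSetoid r a b ≤ s := by
  rintro x y (k | ⟨k, k'⟩ | ⟨k, k'⟩)
  · exact h k
  · exact s.trans (h k) (s.trans hab (s.symm (h k')))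
  · exact s.trans (h k) (s.trans (s.symm hab) (s.symm (h k')))

theorem mergeSetoid_sup (r s : Setoid α) (a b : α) :
    mergeSetoid r a b ⊔ s = mergeSetoid (r ⊔ s) a b := by
  apply le_antisymm
  · exact sup_le (mergeSetoid_le (le_sup_left.trans (le_mergeSetoid _ a b))
      (mergeSetoid_rel _ a b)) (le_sup_right.trans (le_mergeSetoid _ a b))
  · exact mergeSetoid_le (sup_le_sup_right (le_mergeSetoid r a b) s)
      ((le_sup_left : mergeSetoid r a b ≤ _) (mergeSetoid_rel r a b))

theorem mergeSetoid_eq_self {r : Setoid α} {a b : α} (h : r a b) : mergeSetoid r a b = r :=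
  le_antisymm (mergeSetoid_le le_rfl h) (le_mergeSetoid r a b)

theorem card_quotient_le [Finite α] {r s : Setoid α} (h : r ≤ s) :
    Nat.card (Quotient s) ≤ Nat.card (Quotient r) :=
  Nat.card_le_card_of_surjective (Quotient.map' id fun _ _ k => h k) (by
    intro y
    induction y using Quotient.inductionOn with
    | h x => exact ⟨Quotient.mk r x, rfl⟩)

theorem le_of_card_quotient_le [Finite α] {r s : Setoid α} (h : r ≤ s)
    (hc : Nat.card (Quotient r) ≤ Nat.card (Quotient s)) : s ≤ r := by
  intro x y hxy
  have hs : Function.Surjective (Quotient.map' id fun _ _ k => h k : Quotient r → Quotient s) := by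
    intro y
    induction y using Quotient.inductionOn with
    | h x => exact ⟨Quotient.mk r x, rfl⟩
  have hb := (Nat.bijective_iff_surjective_and_card _).2
    ⟨hs, le_antisymm hc (card_quotient_le h)⟩
  have : (Quotient.mk r x) = Quotient.mk r y := hb.1 (Quotient.sound (s := s) hxy)
  exact Quotient.exact this

theorem card_mergeSetoid [Finite α] {r : Setoid α} {a b : α} (h : ¬ r a b) :
    Nat.card (Quotient (mergeSetoid r a b)) + 1 = Nat.card (Quotient r) := by
  classical
  have e : Quotient (mergeSetoid r a b) ≃ {c : Quotient r // c ≠ Quotient.mk r b} := by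
    symm
    refine Equiv.ofBijective
      (fun c => Quotient.map' id (fun _ _ k => le_mergeSetoid r a b k) c.1) ⟨?_, ?_⟩
    · rintro ⟨c, hc⟩ ⟨d, hd⟩
      induction c using Quotient.inductionOn with
      | h x =>
        induction d using Quotient.inductionOn with
        | h y =>
          intro hxy
          have hx : ¬ r x b := fun k => hc (Quotient.sound k)
          have hy : ¬ r y b := fun k => hd (Quotient.sound k)
          have : mergeSetoid r a b x y := Quotient.exact hxy
          rcases this with k | ⟨_, k⟩ | ⟨k, _⟩
          · exact Subtype.ext (Quotient.sound k)
          · exact absurd k hy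
          · exact absurd k hx
    · intro d
      induction d using Quotient.inductionOn with
      | h y =>
        by_cases hy : r y b
        · refine ⟨⟨Quotient.mk r a, fun k => h (Quotient.exact k)⟩, ?_⟩
          exact Quotient.sound (s := mergeSetoid r a b) (Or.inr (Or.inl ⟨r.refl a, hy⟩))
        · exact ⟨⟨Quotient.mk r y, fun k => hy (Quotient.exact k)⟩, rfl⟩
  have := Fintype.ofFinite (Quotient r)
  rw [Nat.card_congr e, Nat.card_eq_fintype_card, Nat.card_eq_fintype_card,
    Fintype.card_subtype_compl, Fintype.card_subtype_eq]
  have : 0 < Fintype.card (Quotient r) := Fintype.card_pos_iff.2 ⟨Quotient.mk r a⟩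
  omega

end Merge

section Orbits

variable {α : Type*}

theorem orbitSetoid_le_iff {σ : Equiv.Perm α} {r : Setoid α} :
    orbitSetoid σ ≤ r ↔ ∀ x, r x (σ x) := by
  constructor
  · intro h x
    exact h (Equiv.Perm.sameCycle_apply_right.2 (Equiv.Perm.SameCycle.refl σ x))
  · rintro h x y ⟨k, rfl⟩
    have hpow : ∀ (n : ℕ) x, r x ((σ ^ n) x) := by
      intro n
      induction n with
      | zero => exact fun x => r.refl x
      | succ n ih =>
        intro x
        rw [pow_succ', Equiv.Perm.mul_apply]
        exact r.trans (ih x) (h _)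
    cases k with
    | ofNat n => exact hpow n x
    | negSucc n =>
      have := hpow (n + 1) ((σ ^ (Int.negSucc n)) x)
      rw [zpow_negSucc, ← Equiv.Perm.mul_apply, mul_inv_cancel] at this
      rw [zpow_negSucc]
      exact r.symm this

theorem sameCycle_self_apply (σ : Equiv.Perm α) (x : α) : σ.SameCycle x (σ x) :=
  Equiv.Perm.sameCycle_apply_right.2 (Equiv.Perm.SameCycle.refl σ x)

theorem orbitSetoid_inv (σ : Equiv.Perm α) : orbitSetoid σ⁻¹ = orbitSetoid σ :=
  Setoid.ext fun _ _ => Equiv.Perm.sameCycle_inv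

theorem numOrbits_inv (σ : Equiv.Perm α) : numOrbits σ⁻¹ = numOrbits σ := by
  rw [numOrbits, numOrbits, orbitSetoid_inv]

theorem numOrbits_conj (σ g : Equiv.Perm α) : numOrbits (g * σ * g⁻¹) = numOrbits σ := by
  refine Nat.card_congr (Quotient.congr g⁻¹ fun x y => ?_)
  exact Equiv.Perm.sameCycle_conj

theorem numOrbits_mul_comm (σ τ : Equiv.Perm α) : numOrbits (σ * τ) = numOrbits (τ * σ) := by
  rw [← numOrbits_conj (τ * σ) σ]
  congr 1
  group

theorem numOrbits_one : numOrbits (1 : Equiv.Perm α) = Nat.card α := by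
  refine (Nat.card_congr (Equiv.ofBijective (Quotient.mk _) ⟨?_, Quotient.mk_surjective⟩)).symm
  intro x y h
  have : (1 : Equiv.Perm α).SameCycle x y := Quotient.exact h
  simpa using this

variable [Finite α]

theorem SameCycle.exists_pos_pow {σ : Equiv.Perm α} {a b : α} (h : σ.SameCycle a b) :
    ∃ k : ℕ, 0 < k ∧ (σ ^ k) a = b := by
  obtain ⟨k, hk, -, h⟩ := h.exists_pow_eq''
  exact ⟨k, hk, h⟩

theorem numOrbits_le_card (σ : Equiv.Perm α) : numOrbits σ ≤ Nat.card α :=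
  Nat.card_le_card_of_surjective _ (Quotient.mk_surjective (s := orbitSetoid σ))

variable [DecidableEq α]

theorem sameCycle_mul_swap {σ : Equiv.Perm α} {a b : α} (h : ¬ σ.SameCycle a b) :
    (σ * Equiv.swap a b).SameCycle a b := by
  have hex := SameCycle.exists_pos_pow (Equiv.Perm.SameCycle.refl σ a)
  have hk := (Nat.find_spec hex).1
  have hka := (Nat.find_spec hex).2
  have hmin := fun j => Nat.find_min hex (m := j)
  set k := Nat.find hex
  have key : ∀ j, j + 1 ≤ k → (σ * Equiv.swap a b).SameCycle b ((σ ^ (j + 1)) a) := by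
    intro j
    induction j with
    | zero =>
      intro _
      have := sameCycle_self_apply (σ * Equiv.swap a b) b
      simpa using this
    | succ j ih =>
      intro hj
      refine (ih (by omega)).trans ?_
      have h1 : (σ ^ (j + 1)) a ≠ a := fun e => hmin (j + 1) (by omega) ⟨by omega, e⟩
      have h2 : (σ ^ (j + 1)) a ≠ b := fun e => h ⟨(j + 1 : ℕ), by rw [zpow_natCast]; exact e⟩
      have := sameCycle_self_apply (σ * Equiv.swap a b) ((σ ^ (j + 1)) a)
      rwa [Equiv.Perm.mul_apply, Equiv.swap_apply_of_ne_of_ne h1 h2, ← Equiv.Perm.mul_apply,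
        ← pow_succ'] at this
  have := key (k - 1) (by omega)
  rw [Nat.sub_add_cancel hk, hka] at this
  exact this.symm

theorem not_sameCycle_mul_swap {σ : Equiv.Perm α} {a b : α} (hab : a ≠ b)
    (h : σ.SameCycle a b) : ¬ (σ * Equiv.swap a b).SameCycle a b := by
  have hex := SameCycle.exists_pos_pow h
  have hk := (Nat.find_spec hex).1
  have hkb := (Nat.find_spec hex).2
  have hmin := fun j => Nat.find_min hex (m := j)
  set k := Nat.find hex
  have hne : ∀ j, 0 < j → j ≤ k → (σ ^ j) a ≠ a := by
    intro j hj hjk e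
    rcases hjk.eq_or_lt with rfl | hjk
    · exact hab (e.symm.trans hkb)
    · refine hmin (k - j) (by omega) ⟨by omega, ?_⟩
      rw [← hkb]
      conv_rhs => rw [← Nat.sub_add_cancel hjk.le, pow_add, Equiv.Perm.mul_apply, e]
  have inv : ∀ n : ℕ, ∃ j, 0 < j ∧ j ≤ k ∧ ((σ * Equiv.swap a b) ^ n) b = (σ ^ j) a := by
    intro n
    induction n with
    | zero => exact ⟨k, hk, le_rfl, hkb.symm⟩
    | succ n ih =>
      obtain ⟨j, hj, hjk, e⟩ := ih
      rw [pow_succ', Equiv.Perm.mul_apply, e]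
      rcases hjk.eq_or_lt with rfl | hjk
      · refine ⟨1, one_pos, hk, ?_⟩
        rw [hkb]
        simp
      · refine ⟨j + 1, by omega, by omega, ?_⟩
        rw [Equiv.Perm.mul_apply, Equiv.swap_apply_of_ne_of_ne (hne j hj hjk.le)
          (fun e' => hmin j hjk ⟨hj, e'⟩), pow_succ', Equiv.Perm.mul_apply]
  intro hc
  obtain ⟨n, -, hn⟩ := SameCycle.exists_pos_pow hc.symm
  obtain ⟨j, hj, hjk, e⟩ := inv n
  exact hne j hj hjk (e.symm.trans hn)

theorem orbitSetoid_mul_swap {σ : Equiv.Perm α} {a b : α} (h : ¬ σ.SameCycle a b) :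
    orbitSetoid (σ * Equiv.swap a b) = mergeSetoid (orbitSetoid σ) a b := by
  have hab := sameCycle_mul_swap h
  apply le_antisymm
  · rw [orbitSetoid_le_iff]
    intro x
    have hx := le_mergeSetoid (orbitSetoid σ) a b
      (sameCycle_self_apply σ (Equiv.swap a b x))
    refine Setoid.trans' _ ?_ hx
    rcases eq_or_ne x a with rfl | hxa
    · rw [Equiv.swap_apply_left]
      exact mergeSetoid_rel _ _ _
    rcases eq_or_ne x b with rfl | hxb
    · rw [Equiv.swap_apply_right]
      exact Setoid.symm' _ (mergeSetoid_rel _ _ _)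
    · rw [Equiv.swap_apply_of_ne_of_ne hxa hxb]
  · refine mergeSetoid_le ?_ hab
    rw [orbitSetoid_le_iff]
    intro x
    have hx := sameCycle_self_apply (σ * Equiv.swap a b) (Equiv.swap a b x)
    rw [Equiv.Perm.mul_apply, Equiv.swap_apply_self] at hx
    refine Equiv.Perm.SameCycle.trans ?_ hx
    rcases eq_or_ne x a with rfl | hxa
    · rwa [Equiv.swap_apply_left]
    rcases eq_or_ne x b with rfl | hxb
    · rw [Equiv.swap_apply_right]
      exact hab.symm
    · rw [Equiv.swap_apply_of_ne_of_ne hxa hxb]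

theorem numOrbits_mul_swap_of_not_sameCycle {σ : Equiv.Perm α} {a b : α}
    (h : ¬ σ.SameCycle a b) : numOrbits (σ * Equiv.swap a b) + 1 = numOrbits σ := by
  rw [numOrbits, orbitSetoid_mul_swap h]
  exact card_mergeSetoid h

theorem numOrbits_mul_swap_of_sameCycle {σ : Equiv.Perm α} {a b : α} (hab : a ≠ b)
    (h : σ.SameCycle a b) : numOrbits (σ * Equiv.swap a b) = numOrbits σ + 1 := by
  rw [← numOrbits_mul_swap_of_not_sameCycle (not_sameCycle_mul_swap hab h), mul_assoc,
    Equiv.swap_mul_self, mul_one]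

theorem numOrbits_mul_swap_le (σ : Equiv.Perm α) (a b : α) :
    numOrbits (σ * Equiv.swap a b) ≤ numOrbits σ + 1 := by
  rcases eq_or_ne a b with rfl | hab
  · rw [Equiv.swap_self, ← Equiv.Perm.one_def, mul_one]
    exact Nat.le_succ _
  by_cases h : σ.SameCycle a b
  · exact (numOrbits_mul_swap_of_sameCycle hab h).le
  · have := numOrbits_mul_swap_of_not_sameCycle h
    omega

/-- Induction on permutations by cutting a cycle in two. -/
theorem cut_induction {P : Equiv.Perm α → Prop} (one : P 1)
    (cut : ∀ σ a b, a ≠ b → σ.SameCycle a b → P (σ * Equiv.swap a b) → P σ)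
    (σ : Equiv.Perm α) : P σ := by
  induction hn : Nat.card α - numOrbits σ using Nat.strong_induction_on generalizing σ with
  | _ n ih =>
    by_cases h : σ = 1
    · exact h ▸ one
    obtain ⟨a, ha⟩ : ∃ a, σ a ≠ a := by
      by_contra! hc
      exact h (Equiv.ext hc)
    have hs := sameCycle_self_apply σ a
    have hN := numOrbits_mul_swap_of_sameCycle ha.symm hs
    have hle := numOrbits_le_card (σ * Equiv.swap a (σ a))
    exact cut σ a (σ a) ha.symm hs (ih _ (by omega) _ rfl)

theorem numOrbits_add_le (σ τ : Equiv.Perm α) :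
    numOrbits σ + numOrbits τ ≤ numOrbits (σ * τ) + Nat.card α := by
  induction τ using cut_induction with
  | one => rw [mul_one, numOrbits_one]
  | cut τ a b hab h ih =>
    rw [numOrbits_mul_swap_of_sameCycle hab h, ← mul_assoc] at ih
    have := numOrbits_mul_swap_le (σ * τ) a b
    omega

end Orbits

section Noncrossing

variable {α : Type*}

theorem numJoin_comm (π ρ : Equiv.Perm α) : numJoin π ρ = numJoin ρ π := by
  rw [numJoin, sup_comm, numJoin]

theorem euler_comm (π ρ : Equiv.Perm α) : euler π ρ = euler ρ π := by
  have : numOrbits (ρ⁻¹ * π) = numOrbits (π⁻¹ * ρ) := by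
    rw [← numOrbits_inv, mul_inv_rev, inv_inv]
  rw [euler, euler, this]
  ring

theorem isNoncrossingOn_comm {π ρ : Equiv.Perm α} :
    IsNoncrossingOn π ρ ↔ IsNoncrossingOn ρ π := by
  rw [IsNoncrossingOn, IsNoncrossingOn, euler_comm, numJoin_comm]

theorem numJoin_of_le {π ρ : Equiv.Perm α} (h : orbitSetoid π ≤ orbitSetoid ρ) :
    numJoin π ρ = numOrbits ρ := by
  rw [numJoin, sup_eq_right.2 h, numOrbits]

/-- `π` lies on a geodesic from the identity to `ρ` in the transposition Cayley graph. -/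
def IsGeodesic (π ρ : Equiv.Perm α) : Prop :=
  numOrbits π + numOrbits (π⁻¹ * ρ) = Nat.card α + numOrbits ρ

theorem permLe.isGeodesic {π ρ : Equiv.Perm α} (h : permLe π ρ) : IsGeodesic π ρ := by
  have h2 := h.2
  rw [IsNoncrossingOn, numJoin_of_le (fun _ _ k => h.1 _ _ k), euler] at h2
  rw [IsGeodesic]
  omega

/-- `FirstReturn σ J a b` holds when `b` is the first point of `J` on the forward `σ`-orbit of
`a`, the point `a` itself excluded. -/
inductive FirstReturn (σ : Equiv.Perm α) (J : Set α) : α → α → Prop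
  | base (a : α) : σ a ∈ J → FirstReturn σ J a (σ a)
  | step (a b : α) : σ a ∉ J → FirstReturn σ J (σ a) b → FirstReturn σ J a b

theorem firstReturn_pow {σ : Equiv.Perm α} {J : Set α} {k : ℕ} {a : α} (hk : 0 < k)
    (h : (σ ^ k) a ∈ J) (hj : ∀ j, 0 < j → j < k → (σ ^ j) a ∉ J) :
    FirstReturn σ J a ((σ ^ k) a) := by
  induction k generalizing a with
  | zero => exact absurd hk (lt_irrefl 0)
  | succ k ih =>
    rcases Nat.eq_zero_or_pos k with rfl | hk'
    · simpa using FirstReturn.base a (by simpa using h)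
    · have hs : ∀ j, (σ ^ j) (σ a) = (σ ^ (j + 1)) a := fun j => by
        rw [pow_succ, Equiv.Perm.mul_apply]
      refine FirstReturn.step a _ (by simpa using hj 1 one_pos (by omega)) ?_
      rw [← hs] at h ⊢
      refine ih hk' h fun j h0 hjk => ?_
      rw [hs]
      exact hj _ (by omega) (by omega)

variable [DecidableEq α]

theorem FirstReturn.mul_swap {σ : Equiv.Perm α} {J : Set α} {x a b : α} (hx : x ∉ J)
    (hσ : σ x ≠ x) (h : FirstReturn σ J a b) :
    (a ≠ x → FirstReturn (σ * Equiv.swap (σ⁻¹ x) x) J a b) ∧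
      (a = x → (σ x ∈ J ∧ b = σ x) ∨
        (σ x ∉ J ∧ FirstReturn (σ * Equiv.swap (σ⁻¹ x) x) J (σ x) b)) := by
  have hne : ∀ a, a ≠ x → σ a ≠ x → (σ * Equiv.swap (σ⁻¹ x) x) a = σ a := by
    intro a h1 h2
    rw [Equiv.Perm.mul_apply, Equiv.swap_apply_of_ne_of_ne _ h1]
    rintro rfl
    simp at h2
  have heq : ∀ a, σ a = x → (σ * Equiv.swap (σ⁻¹ x) x) a = σ x := by
    rintro a rfl
    simp
  induction h with
  | base a ha =>
    refine ⟨fun hax => ?_, ?_⟩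
    · have e := hne a hax (fun e => hx (e ▸ ha))
      have := FirstReturn.base (σ := σ * Equiv.swap (σ⁻¹ x) x) (J := J) a (by rwa [e])
      rwa [e] at this
    · rintro rfl
      exact Or.inl ⟨ha, rfl⟩
  | step a b ha _ ih =>
    refine ⟨fun hax => ?_, ?_⟩
    · by_cases hax' : σ a = x
      · have e := heq a hax'
        rcases ih.2 hax' with ⟨h1, rfl⟩ | ⟨h1, h2⟩
        · have := FirstReturn.base (σ := σ * Equiv.swap (σ⁻¹ x) x) (J := J) a (by rwa [e])
          rwa [e] at this
        · exact FirstReturn.step a b (by rwa [e]) (by rwa [e])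
      · have e := hne a hax hax'
        exact FirstReturn.step a b (by rwa [e]) (by rw [e]; exact ih.1 hax')
    · rintro rfl
      exact Or.inr ⟨ha, ih.1 hσ⟩

variable [Finite α]

/-- Cutting a cycle of `π` does not increase the defect `2·#(Π(π) ∨ Π(ρ)) - χ_ρ(π)`. -/
theorem defect_mul_swap_le {π : Equiv.Perm α} (ρ : Equiv.Perm α) {a b : α} (hab : a ≠ b)
    (h : π.SameCycle a b) :
    2 * (numJoin (π * Equiv.swap a b) ρ : ℤ) - euler ρ (π * Equiv.swap a b) ≤
      2 * (numJoin π ρ : ℤ) - euler ρ π := by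
  obtain ⟨π', rfl⟩ : ∃ π', π = π' * Equiv.swap a b := ⟨π * Equiv.swap a b, by simp⟩
  have hn : ¬ π'.SameCycle a b := by simpa using not_sameCycle_mul_swap hab h
  rw [mul_assoc, Equiv.swap_mul_self, mul_one]
  have hN := numOrbits_mul_swap_of_not_sameCycle hn
  have hκ : numOrbits ((π' * Equiv.swap a b)⁻¹ * ρ) =
      numOrbits (ρ⁻¹ * π' * Equiv.swap a b) := by
    rw [← numOrbits_inv]
    simp [mul_assoc]
  have hκ' : numOrbits (π'⁻¹ * ρ) = numOrbits (ρ⁻¹ * π') := by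
    rw [← numOrbits_inv]
    simp
  have hJ : orbitSetoid (π' * Equiv.swap a b) ⊔ orbitSetoid ρ =
      mergeSetoid (orbitSetoid π' ⊔ orbitSetoid ρ) a b := by
    rw [orbitSetoid_mul_swap hn, mergeSetoid_sup]
  simp only [euler, hκ, hκ']
  by_cases hj : (orbitSetoid π' ⊔ orbitSetoid ρ) a b
  · have hJ' : numJoin (π' * Equiv.swap a b) ρ = numJoin π' ρ := by
      rw [numJoin, hJ, mergeSetoid_eq_self hj, numJoin]
    have := numOrbits_mul_swap_le (ρ⁻¹ * π') a b
    omega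
  · have hJ' : numJoin (π' * Equiv.swap a b) ρ + 1 = numJoin π' ρ := by
      rw [numJoin, hJ, card_mergeSetoid hj, numJoin]
    have hk : ¬ (ρ⁻¹ * π').SameCycle a b := by
      refine fun hc => hj ((orbitSetoid_le_iff.2 fun x => ?_ : orbitSetoid (ρ⁻¹ * π') ≤ _) hc)
      refine Setoid.trans' _ ((le_sup_left : orbitSetoid π' ≤ _) (sameCycle_self_apply π' x)) ?_
      refine (le_sup_right : orbitSetoid ρ ≤ _) ?_
      exact Equiv.Perm.sameCycle_inv.1 (sameCycle_self_apply ρ⁻¹ (π' x))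
    have := numOrbits_mul_swap_of_not_sameCycle hk
    omega

theorem euler_le (π ρ : Equiv.Perm α) : euler ρ π ≤ 2 * (numJoin π ρ : ℤ) := by
  induction π using cut_induction with
  | one =>
    have : numJoin 1 ρ = numOrbits ρ :=
      numJoin_of_le (orbitSetoid_le_iff.2 fun x => Setoid.refl' _ x)
    rw [this, euler, numOrbits_one, inv_one, one_mul]
    omega
  | cut π a b hab h ih =>
    have := defect_mul_swap_le ρ hab h
    omega

theorem IsNoncrossingOn.mul_swap_left {π ρ : Equiv.Perm α} (hnc : IsNoncrossingOn π ρ) {a b : α}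
    (hab : a ≠ b) (h : π.SameCycle a b) : IsNoncrossingOn (π * Equiv.swap a b) ρ := by
  have h1 := defect_mul_swap_le ρ hab h
  have h2 := euler_le (π * Equiv.swap a b) ρ
  rw [IsNoncrossingOn] at hnc ⊢
  omega

theorem IsGeodesic.permLe {π ρ : Equiv.Perm α} (h : IsGeodesic π ρ) : permLe π ρ := by
  have hle := euler_le π ρ
  rw [IsGeodesic] at h
  have hr : orbitSetoid π ⊔ orbitSetoid ρ ≤ orbitSetoid ρ := by
    refine le_of_card_quotient_le le_sup_right ?_
    change numOrbits ρ ≤ numJoin π ρ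
    rw [euler] at hle
    omega
  have hr' := le_sup_left.trans hr
  refine ⟨fun _ _ k => hr' k, ?_⟩
  rw [IsNoncrossingOn, numJoin_of_le hr', euler]
  omega

theorem IsNoncrossingOn.of_isGeodesic {π ρ τ : Equiv.Perm α} (hnc : IsNoncrossingOn π τ)
    (h : IsGeodesic ρ τ) : IsNoncrossingOn π ρ := by
  obtain ⟨η, rfl⟩ : ∃ η, τ = ρ * η := ⟨ρ⁻¹ * τ, by simp⟩
  induction η using cut_induction with
  | one => simpa using hnc
  | cut η a b hab hη ih =>
    rw [IsGeodesic, inv_mul_cancel_left] at h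
    have hN := numOrbits_mul_swap_of_sameCycle hab hη
    have hsub := numOrbits_add_le ρ (η * Equiv.swap a b)
    rw [← mul_assoc] at hsub
    have hc : (ρ * η).SameCycle a b := by
      by_contra hc
      have := numOrbits_mul_swap_of_not_sameCycle hc
      omega
    have hN' := numOrbits_mul_swap_of_sameCycle hab hc
    apply ih
    · rw [← mul_assoc]
      exact isNoncrossingOn_comm.1 ((isNoncrossingOn_comm.1 hnc).mul_swap_left hab hc)
    · rw [IsGeodesic, inv_mul_cancel_left, ← mul_assoc]
      omega

/-- Noncrossing is inherited by the permutation induced on a subset. -/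
theorem exists_induced_noncrossing {σ ρ : Equiv.Perm α} {J : Set α} {f : α → α}
    (hnc : IsNoncrossingOn σ ρ) (hf : ∀ a ∈ J, FirstReturn σ J a (f a)) :
    ∃ σ' : Equiv.Perm α, IsNoncrossingOn σ' ρ ∧ (∀ a ∈ J, σ' a = f a) ∧ ∀ a ∉ J, σ' a = a := by
  induction hn : Nat.card α - numOrbits σ using Nat.strong_induction_on generalizing σ with
  | _ n ih =>
    by_cases h : ∃ x, x ∉ J ∧ σ x ≠ x
    · obtain ⟨x, hx, hσ⟩ := h
      have hne : σ⁻¹ x ≠ x := fun e => hσ (by conv_lhs => rw [← e]; simp)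
      have hs : σ.SameCycle (σ⁻¹ x) x := by simpa using sameCycle_self_apply σ (σ⁻¹ x)
      have hN := numOrbits_mul_swap_of_sameCycle hne hs
      have hle := numOrbits_le_card (σ * Equiv.swap (σ⁻¹ x) x)
      refine ih _ (by omega) (hnc.mul_swap_left hne hs) (fun a ha => ?_) rfl
      exact ((hf a ha).mul_swap hx hσ).1 (fun e => hx (e ▸ ha))
    · push Not at h
      refine ⟨σ, hnc, fun a ha => ?_, h⟩
      have key : ∀ b, FirstReturn σ J a b → σ a = b := by
        intro b hb
        cases hb with
        | base => rfl
        | step _ _ h1 _ =>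
          have := σ.injective (h _ h1)
          rw [this] at h1
          exact absurd ha h1
      exact key _ (hf a ha)

end Noncrossing

section Tau

variable {p q : ℕ}

theorem tauPQ_castAdd (i : Fin p) :
    tauPQ p q (Fin.castAdd q i) = Fin.castAdd q (finRotate p i) := by
  simp [tauPQ, Equiv.permCongr_apply]

theorem tauPQ_natAdd (i : Fin q) :
    tauPQ p q (Fin.natAdd p i) = Fin.natAdd p (finRotate q i) := by
  simp [tauPQ, Equiv.permCongr_apply]

theorem finRotate_mk {n i : ℕ} (h : i + 1 < n) :
    finRotate n ⟨i, by omega⟩ = ⟨i + 1, h⟩ := by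
  obtain ⟨m, rfl⟩ : ∃ m, n = m + 1 := ⟨n - 1, by omega⟩
  exact finRotate_of_lt (by omega)

theorem finRotate_orbit_le {n : ℕ} {r : Setoid (Fin n)} (h : ∀ i, r i (finRotate n i))
    (i j : Fin n) : r i j := by
  have key : ∀ (k : ℕ) (hk : k < n), r ⟨0, by omega⟩ ⟨k, hk⟩ := by
    intro k
    induction k with
    | zero => exact fun _ => r.refl _
    | succ k ih =>
      intro hk
      have := h ⟨k, by omega⟩
      rw [finRotate_mk hk] at this
      exact r.trans (ih _) this
  exact r.trans (r.symm (key i i.2)) (key j j.2)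

theorem tauPQ_sameCycle_iff (x y : Fin (p + q)) :
    (tauPQ p q).SameCycle x y ↔ ((x : ℕ) < p ↔ (y : ℕ) < p) := by
  constructor
  · intro h
    refine (orbitSetoid_le_iff.2 fun z => ?_ : orbitSetoid (tauPQ p q) ≤
      Setoid.ker fun z : Fin (p + q) => (z : ℕ) < p) h |> iff_of_eq
    induction z using Fin.addCases with
    | left i => simp [Setoid.ker_def, tauPQ_castAdd]
    | right i => simp [Setoid.ker_def, tauPQ_natAdd]
  · intro h
    have hl : ∀ i j : Fin p, (tauPQ p q).SameCycle (Fin.castAdd q i) (Fin.castAdd q j) :=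
      finRotate_orbit_le (r := (orbitSetoid (tauPQ p q)).comap (Fin.castAdd q)) fun i => by
        change (tauPQ p q).SameCycle _ _
        rw [← tauPQ_castAdd]
        exact sameCycle_self_apply _ _
    have hr : ∀ i j : Fin q, (tauPQ p q).SameCycle (Fin.natAdd p i) (Fin.natAdd p j) :=
      finRotate_orbit_le (r := (orbitSetoid (tauPQ p q)).comap (Fin.natAdd p)) fun i => by
        change (tauPQ p q).SameCycle _ _
        rw [← tauPQ_natAdd]
        exact sameCycle_self_apply _ _
    induction x using Fin.addCases with
    | left i =>
      induction y using Fin.addCases with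
      | left j => exact hl i j
      | right j => simp at h
    | right i =>
      induction y using Fin.addCases with
      | left j => simp at h
      | right j => exact hr i j

end Tau

section Annular

variable {p q : ℕ} {π ρ π₀ : Equiv.Perm (Fin (p + q))}

theorem SDiscNC.isGeodesic (hρ : ρ ∈ SDiscNC p q) : IsGeodesic ρ (tauPQ p q) :=
  permLe.isGeodesic ⟨fun x y h => (tauPQ_sameCycle_iff x y).2 (hρ.2 x y h), hρ.1⟩

theorem SAnnNC.isNoncrossingOn_disc (hπ : π ∈ SAnnNC p q) (hρ : ρ ∈ SDiscNC p q) :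
    IsNoncrossingOn π ρ :=
  IsNoncrossingOn.of_isGeodesic hπ.1 (SDiscNC.isGeodesic hρ)

theorem SAnnNC.numJoin_tauPQ (hπ : π ∈ SAnnNC p q) :
    numJoin π (tauPQ p q) + 1 = numOrbits (tauPQ p q) := by
  obtain ⟨-, a, b, hab, ha, hb⟩ := hπ
  have h : orbitSetoid π ⊔ orbitSetoid (tauPQ p q) =
      mergeSetoid (orbitSetoid (tauPQ p q)) a b := by
    apply le_antisymm
    · refine sup_le (fun x y _ => ?_) (le_mergeSetoid _ a b)
      have hs := fun x y => (tauPQ_sameCycle_iff (p := p) (q := q) x y).2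
      by_cases hx : (x : ℕ) < p <;> by_cases hy : (y : ℕ) < p
      · exact Or.inl (hs _ _ (by omega))
      · exact Or.inr (Or.inl ⟨hs _ _ (by omega), hs _ _ (by omega)⟩)
      · exact Or.inr (Or.inr ⟨hs _ _ (by omega), hs _ _ (by omega)⟩)
      · exact Or.inl (hs _ _ (by omega))
    · exact mergeSetoid_le le_sup_right ((le_sup_left : orbitSetoid π ≤ _) hab)
  rw [numJoin, h]
  refine card_mergeSetoid fun hc => ?_
  have := (tauPQ_sameCycle_iff a b).1 hc
  omega

theorem leAnnHat_iff_numJoin (hπ : π ∈ SAnnNC p q) (hρ : ρ ∈ SDiscNC p q) :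
    leAnnHat p q π ρ ↔ numJoin π ρ + 1 = numOrbits ρ := by
  have h1 := SDiscNC.isGeodesic hρ
  have h2 := SAnnNC.numJoin_tauPQ hπ
  have h3 := hπ.1
  have h4 := SAnnNC.isNoncrossingOn_disc hπ hρ
  rw [IsNoncrossingOn, euler] at h3 h4
  rw [IsGeodesic] at h1
  have hc : numOrbits ((ρ⁻¹ * tauPQ p q)⁻¹ * (π⁻¹ * tauPQ p q)) = numOrbits (π⁻¹ * ρ) := by
    rw [← numOrbits_mul_comm ρ, ← numOrbits_conj (ρ * π⁻¹) (tauPQ p q)⁻¹]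
    simp [mul_assoc]
  have h5 : IsGeodesic (ρ⁻¹ * tauPQ p q) (π⁻¹ * tauPQ p q) ↔ numJoin π ρ + 1 = numOrbits ρ := by
    rw [IsGeodesic, hc]
    omega
  exact ⟨fun h => h5.1 (permLe.isGeodesic h), fun h => (h5.2 h).permLe⟩

theorem IsPiZero.lt_iff (h : IsPiZero p q π π₀) (x : Fin (p + q)) :
    (x : ℕ) < p ↔ (π₀ x : ℕ) < p := by
  obtain ⟨k, -, hk, hs, -⟩ := h x
  rwa [hk]

theorem IsPiZero.sameCycle (h : IsPiZero p q π π₀) (x : Fin (p + q)) :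
    π.SameCycle x (π₀ x) := by
  obtain ⟨k, -, hk, -⟩ := h x
  exact ⟨k, by rw [hk, zpow_natCast]⟩

theorem IsPiZero.apply_eq (h : IsPiZero p q π π₀) {x : Fin (p + q)}
    (hx : (x : ℕ) < p ↔ (π x : ℕ) < p) : π₀ x = π x := by
  obtain ⟨k, h0, hk, -, hj⟩ := h x
  have : k = 1 := by
    by_contra hne
    exact hj 1 one_pos (by omega) (by simpa using hx)
  simpa [this] using hk

theorem IsPiZero.isNoncrossingOn (h : IsPiZero p q π π₀) (hnc : IsNoncrossingOn π ρ)
    (hρ : ∀ x y : Fin (p + q), ρ.SameCycle x y → ((x : ℕ) < p ↔ (y : ℕ) < p))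
    (hle : orbitSetoid π₀ ≤ orbitSetoid ρ) : IsNoncrossingOn π₀ ρ := by
  have hle' := orbitSetoid_le_iff.1 hle
  obtain ⟨σ, hσ, hσ1, hσ2⟩ := exists_induced_noncrossing
    (J := {x : Fin (p + q) | (x : ℕ) < p}) (f := π₀) hnc (by
      intro a (ha : (a : ℕ) < p)
      obtain ⟨k, h0, hk, hs, hj⟩ := h a
      rw [hk]
      exact firstReturn_pow h0 (hs.1 ha) fun j h1 h2 h3 => hj j h1 h2 (iff_of_true ha h3))
  obtain ⟨σ', hσ', hσ1', hσ2'⟩ := exists_induced_noncrossing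
    (J := {x : Fin (p + q) | ¬ (x : ℕ) < p}) (f := π₀) hnc (by
      intro a (ha : ¬ (a : ℕ) < p)
      obtain ⟨k, h0, hk, hs, hj⟩ := h a
      rw [hk]
      exact firstReturn_pow h0 (fun hc => ha (hs.2 hc))
        fun j h1 h2 h3 => hj j h1 h2 (iff_of_false ha h3))
  have hmul : π₀ = σ * σ' := by
    ext1 x
    by_cases hx : (x : ℕ) < p
    · rw [Equiv.Perm.mul_apply, hσ2' x (fun hc => hc hx), hσ1 x hx]
    · rw [Equiv.Perm.mul_apply, hσ1' x hx, hσ2 _ (fun hc => hx ((h.lt_iff x).2 hc))]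
  have hσle : orbitSetoid σ ≤ orbitSetoid ρ := orbitSetoid_le_iff.2 fun x => by
    by_cases hx : (x : ℕ) < p
    · rw [hσ1 x hx]
      exact hle' x
    · rw [hσ2 x hx]
  have g1 : IsGeodesic σ ρ := permLe.isGeodesic ⟨fun _ _ k => hσle k, hσ⟩
  have g2 : IsGeodesic (σ⁻¹ * ρ) ρ := by
    rw [IsGeodesic] at g1 ⊢
    rw [mul_inv_rev, inv_inv, mul_assoc, numOrbits_mul_comm ρ⁻¹, mul_assoc, mul_inv_cancel, mul_one]
    omega
  have hagree : ∀ x : Fin (p + q), ¬ (x : ℕ) < p → ∀ n : ℕ, ((σ⁻¹ * ρ) ^ n) x = (ρ ^ n) x := by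
    intro x hx n
    induction n with
    | zero => rfl
    | succ n ih =>
      rw [pow_succ', Equiv.Perm.mul_apply, ih, Equiv.Perm.mul_apply, Equiv.Perm.inv_eq_iff_eq,
        ← Equiv.Perm.mul_apply, ← pow_succ', hσ2]
      exact fun hc => hx ((hρ x _ ⟨(n + 1 : ℕ), by rw [zpow_natCast]⟩).2 hc)
  have hσle' : orbitSetoid σ' ≤ orbitSetoid (σ⁻¹ * ρ) := orbitSetoid_le_iff.2 fun x => by
    by_cases hx : (x : ℕ) < p
    · rw [hσ2' x (fun hc => hc hx)]
    · rw [hσ1' x hx]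
      obtain ⟨n, -, hn⟩ := SameCycle.exists_pos_pow (hle' x)
      exact ⟨n, by rw [zpow_natCast, hagree x hx, hn]⟩
  have g3 : IsGeodesic σ' (σ⁻¹ * ρ) :=
    permLe.isGeodesic ⟨fun _ _ k => hσle' k, hσ'.of_isGeodesic g2⟩
  have s1 := numOrbits_add_le σ σ'
  have s2 := numOrbits_add_le π₀ (π₀⁻¹ * ρ)
  have e : σ'⁻¹ * (σ⁻¹ * ρ) = π₀⁻¹ * ρ := by rw [hmul]; group
  rw [mul_inv_cancel_left] at s2
  rw [← hmul] at s1
  refine (IsGeodesic.permLe ?_).2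
  rw [IsGeodesic] at g1 g3 ⊢
  rw [e] at g3
  omega

end Annular

end AnnNC

open AnnNC in
/-- for `π ∈ S_ann-nc(p,q)` and `ρ ∈ S_disc-nc(p,q)`, one has `π ⪯ ρ̂`
in `S_nc-sd(p,q)` iff `π₀ ⪯ ρ` (orbit refinement plus noncrossing) and all bridges of `π`
are contained in the union of two cycles of `ρ`, one contained in `[p]` and one
in `[p+1,p+q]`. -/
theorem stmt3 (p q : ℕ) (hp : 1 ≤ p) (hq : 1 ≤ q)
    (π ρ : Equiv.Perm (Fin (p + q))) (hπ : π ∈ SAnnNC p q) (hρ : ρ ∈ SDiscNC p q)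
    (π₀ : Equiv.Perm (Fin (p + q))) (hπ₀ : IsPiZero p q π π₀) :
    leAnnHat p q π ρ ↔
      ((∀ x y : Fin (p + q), π₀.SameCycle x y → ρ.SameCycle x y) ∧
       IsNoncrossingOn π₀ ρ ∧
       ∃ u v : Fin (p + q), (u : ℕ) < p ∧ p ≤ (v : ℕ) ∧
         ∀ x ∈ BridgeSet p q π, ρ.SameCycle u x ∨ ρ.SameCycle v x) := by
  classical
  obtain ⟨a, b, hab, ha, hb⟩ := hπ.2
  have hnab : ¬ (orbitSetoid ρ) a b := fun hc => by
    have := hρ.2 a b hc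
    omega
  have hcard := card_mergeSetoid hnab
  have hmle : mergeSetoid (orbitSetoid ρ) a b ≤ orbitSetoid π ⊔ orbitSetoid ρ :=
    mergeSetoid_le le_sup_right ((le_sup_left : orbitSetoid π ≤ _) hab)
  rw [leAnnHat_iff_numJoin hπ hρ]
  constructor
  · intro hJ
    have hle : orbitSetoid π ≤ mergeSetoid (orbitSetoid ρ) a b :=
      le_sup_left.trans (le_of_card_quotient_le hmle (by
        change _ ≤ numJoin π ρ
        change _ = numOrbits ρ at hcard
        omega))
    have hle₀ : orbitSetoid π₀ ≤ orbitSetoid ρ := orbitSetoid_le_iff.2 fun x => by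
      have hs := hπ₀.lt_iff x
      rcases hle (hπ₀.sameCycle x) with h | ⟨h, h'⟩ | ⟨h, h'⟩
      · exact h
      · have := hρ.2 _ _ h
        have := hρ.2 _ _ h'
        omega
      · have := hρ.2 _ _ h
        have := hρ.2 _ _ h'
        omega
    refine ⟨fun _ _ k => hle₀ k,
      hπ₀.isNoncrossingOn (SAnnNC.isNoncrossingOn_disc hπ hρ) hρ.2 hle₀, a, b, ha, hb, ?_⟩
    rintro x ⟨c, d, hc, hd, hcp, hdp⟩
    rcases hle hc with h | ⟨h, -⟩ | ⟨h, -⟩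
    · rcases hle hd with h' | ⟨h', -⟩ | ⟨h', -⟩
      · have := hρ.2 _ _ h
        have := hρ.2 _ _ h'
        omega
      · exact Or.inl (Equiv.Perm.SameCycle.symm h')
      · exact Or.inr (Equiv.Perm.SameCycle.symm h')
    · exact Or.inl (Equiv.Perm.SameCycle.symm h)
    · exact Or.inr (Equiv.Perm.SameCycle.symm h)
  · rintro ⟨hle₀, -, u, v, hu, hv, hB⟩
    have hBa : ∀ x ∈ BridgeSet p q π, (x : ℕ) < p → ρ.SameCycle u x := by
      intro x hx hxp
      refine (hB x hx).resolve_right fun h => ?_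
      have := hρ.2 _ _ h
      omega
    have hBb : ∀ x ∈ BridgeSet p q π, p ≤ (x : ℕ) → ρ.SameCycle v x := by
      intro x hx hxp
      refine (hB x hx).resolve_left fun h => ?_
      have := hρ.2 _ _ h
      omega
    have hua := hBa a ⟨a, b, Equiv.Perm.SameCycle.refl π a, hab, ha, hb⟩ ha
    have hvb := hBb b ⟨a, b, hab.symm, Equiv.Perm.SameCycle.refl π b, ha, hb⟩ hb
    have hle : orbitSetoid π ≤ mergeSetoid (orbitSetoid ρ) a b :=
      orbitSetoid_le_iff.2 fun x => by
        have hx := sameCycle_self_apply π x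
        by_cases h1 : (x : ℕ) < p <;> by_cases h2 : (π x : ℕ) < p
        · refine Or.inl (hle₀ _ _ ?_)
          rw [← hπ₀.apply_eq (iff_of_true h1 h2)]
          exact sameCycle_self_apply π₀ x
        · have k1 := hBa x ⟨x, π x, Equiv.Perm.SameCycle.refl π x, hx, h1, by omega⟩ h1
          have k2 := hBb (π x) ⟨x, π x, hx.symm, Equiv.Perm.SameCycle.refl π _, h1, by omega⟩
            (by omega)
          exact Or.inr (Or.inl ⟨k1.symm.trans hua, k2.symm.trans hvb⟩)
        · have k1 := hBb x ⟨π x, x, hx, Equiv.Perm.SameCycle.refl π x, h2, by omega⟩ (by omega)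
          have k2 := hBa (π x) ⟨π x, x, Equiv.Perm.SameCycle.refl π _, hx.symm, h2, by omega⟩ h2
          exact Or.inr (Or.inr ⟨k1.symm.trans hvb, k2.symm.trans hua⟩)
        · refine Or.inl (hle₀ _ _ ?_)
          rw [← hπ₀.apply_eq (iff_of_false h1 h2)]
          exact sameCycle_self_apply π₀ x
    rw [numJoin, le_antisymm (sup_le hle (le_mergeSetoid _ a b)) hmle]
    exact hcard
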